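/- Let f : X → L̄⁰ be σ_s-lower semi-continuous. Then the function F : L⁰(X) → L̄⁰ defined by F(x) = sup_{V ∈ 𝒱(x)} inf { f_s(x̃) : x̃ ∈ V ∩ L⁰ₛ(X) } (suprema and infima in the a.e.-least-upper-bound sense; each set V ∩ L⁰ₛ(X) is nonempty) is well defined, stable, σ_s-lower semi-continuous, and satisfies F(x·1_Ω) = f(x) a.e. for every x ∈ X. Moreover, if f is proper convex, then F is L⁰-proper convex. -/

import Mathlib

open MeasureTheory Filter Set Function Topology

noncomputable section

section Defs

variable {Ω : Type*} [MeasurableSpace Ω] {X : Type*}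

/-- `x : Ω → X` is a step function (countably-valued strongly measurable function),
i.e. it agrees `μ`-a.e. with `Σₖ xₖ 1_{Aₖ}` for a sequence `(xₖ)` in `X` and a countable
measurable partition `(Aₖ)` of `Ω`. -/
def IsStep (μ : Measure Ω) (x : Ω → X) : Prop :=
  ∃ (xs : ℕ → X) (A : ℕ → Set Ω), (∀ k, MeasurableSet (A k)) ∧
    Pairwise (Disjoint on A) ∧ (⋃ k, A k) = Set.univ ∧
    ∀ᵐ ω ∂μ, ∀ k, ω ∈ A k → x ω = xs k

/-- `xt` is a step function and `g` is a version of its image `f_s(xt)` under the extension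
of `f : X → L̄⁰` to step functions. -/
def StepPair (μ : Measure Ω) (f : X → Ω → EReal) (xt : Ω → X) (g : Ω → EReal) : Prop :=
  ∃ (xs : ℕ → X) (A : ℕ → Set Ω), (∀ k, MeasurableSet (A k)) ∧
    Pairwise (Disjoint on A) ∧ (⋃ k, A k) = Set.univ ∧
    ∀ᵐ ω ∂μ, ∀ k, ω ∈ A k → xt ω = xs k ∧ g ω = f (xs k) ω

/-- `s` is a/the a.e. least upper bound (essential supremum) of the family `g`. -/
def IsAESup (μ : Measure Ω) {ι : Sort*} (g : ι → Ω → EReal) (s : Ω → EReal) : Prop :=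
  Measurable s ∧ (∀ i, ∀ᵐ ω ∂μ, g i ω ≤ s ω) ∧
    ∀ h : Ω → EReal, Measurable h → (∀ i, ∀ᵐ ω ∂μ, g i ω ≤ h ω) → ∀ᵐ ω ∂μ, s ω ≤ h ω

/-- `s` is a/the a.e. greatest lower bound (essential infimum) of the family `g`. -/
def IsAEInf (μ : Measure Ω) {ι : Sort*} (g : ι → Ω → EReal) (s : Ω → EReal) : Prop :=
  Measurable s ∧ (∀ i, ∀ᵐ ω ∂μ, s ω ≤ g i ω) ∧
    ∀ h : Ω → EReal, Measurable h → (∀ i, ∀ᵐ ω ∂μ, h ω ≤ g i ω) → ∀ᵐ ω ∂μ, h ω ≤ s ω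

end Defs

/-- The weak topology `σ(X,Y)` on `X` induced by a bilinear pairing `B : X × Y → ℝ`,
i.e. the coarsest topology making all maps `x ↦ B x y`, `y ∈ Y`, continuous. -/
def weakTopol {X Y : Type*} [AddCommGroup X] [Module ℝ X] [AddCommGroup Y] [Module ℝ Y]
    (B : X →ₗ[ℝ] Y →ₗ[ℝ] ℝ) : TopologicalSpace X :=
  TopologicalSpace.induced (fun x (y : Y) => B x y) Pi.topologicalSpace

section Nbhd

variable {Ω : Type*} [MeasurableSpace Ω]

/-- The parameters `(r, n, (yₘ))` of a basic stable neighborhood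
`V(x; r, n, (yₘ))` in `L⁰(X)`. -/
structure NbhdParam (μ : Measure Ω) (Y : Type*) [NormedAddCommGroup Y] where
  r : Ω → ℝ
  r_meas : Measurable r
  r_pos : ∀ ω, 0 < r ω
  n : Ω → ℕ
  n_meas : Measurable n
  ys : ℕ → Ω → Y
  ys_meas : ∀ m, AEStronglyMeasurable (ys m) μ

end Nbhd

section Stable

variable {Ω : Type*} [MeasurableSpace Ω]
variable {X Y : Type*} [NormedAddCommGroup X] [NormedSpace ℝ X]
  [NormedAddCommGroup Y] [NormedSpace ℝ Y]

/-- `xt` belongs to the basic stable neighborhood `V(x; r, n, (yₘ))` of `x`: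
for `μ`-a.e. `ω`, `|⟨xt(ω) - x(ω), yₘ(ω)⟩| ≤ r(ω)` for all `1 ≤ m ≤ n(ω)`. -/
def NbhdParam.Mem (B : X →ₗ[ℝ] Y →ₗ[ℝ] ℝ) {μ : Measure Ω} (V : NbhdParam μ Y)
    (x xt : Ω → X) : Prop :=
  ∀ᵐ ω ∂μ, ∀ m : ℕ, 1 ≤ m → m ≤ V.n ω → |B (xt ω - x ω) (V.ys m ω)| ≤ V.r ω

/-- σ_s-lower semi-continuity of `f : X → L̄⁰`:
`f(x) = sup_{V ∈ 𝒱(x)} inf { f_s(xt) : xt ∈ V ∩ L⁰ₛ(X) }` for every `x ∈ X`. -/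
def SigmaSLsc (μ : Measure Ω) (B : X →ₗ[ℝ] Y →ₗ[ℝ] ℝ) (f : X → Ω → EReal) : Prop :=
  ∀ x : X, ∃ I : NbhdParam μ Y → Ω → EReal,
    (∀ V : NbhdParam μ Y,
      IsAEInf μ (fun p : {p : (Ω → X) × (Ω → EReal) //
        StepPair μ f p.1 p.2 ∧ V.Mem B (fun _ => x) p.1} => p.1.2) (I V)) ∧
    IsAESup μ I (f x)

/-- σ_s-lower semi-continuity of `F : L⁰(X) → L̄⁰`:
`F(x) = sup_{V ∈ 𝒱(x)} inf { F(z) : z ∈ V }` for every `x ∈ L⁰(X)`. -/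
def SigmaSLscL0 (μ : Measure Ω) (B : X →ₗ[ℝ] Y →ₗ[ℝ] ℝ)
    (F : (Ω → X) → Ω → EReal) : Prop :=
  ∀ x : Ω → X, AEStronglyMeasurable x μ → ∃ I : NbhdParam μ Y → Ω → EReal,
    (∀ V : NbhdParam μ Y,
      IsAEInf μ
        (fun z : {z : Ω → X // AEStronglyMeasurable z μ ∧ V.Mem B x z} => F z.1) (I V)) ∧
    IsAESup μ I (F x)

/-- `F` satisfies the canonical-extension formula
`F(x) = sup_{V ∈ 𝒱(x)} inf { f_s(xt) : xt ∈ V ∩ L⁰ₛ(X) }` for every `x ∈ L⁰(X)`. -/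
def IsCanonicalExt (μ : Measure Ω) (B : X →ₗ[ℝ] Y →ₗ[ℝ] ℝ)
    (f : X → Ω → EReal) (F : (Ω → X) → Ω → EReal) : Prop :=
  ∀ x : Ω → X, AEStronglyMeasurable x μ → ∃ I : NbhdParam μ Y → Ω → EReal,
    (∀ V : NbhdParam μ Y,
      IsAEInf μ (fun p : {p : (Ω → X) × (Ω → EReal) //
        StepPair μ f p.1 p.2 ∧ V.Mem B x p.1} => p.1.2) (I V)) ∧
    IsAESup μ I (F x)

/-- Stability of `F : L⁰(X) → L̄⁰` under countable concatenations:
`F(Σₖ xₖ 1_{Aₖ}) = Σₖ F(xₖ) 1_{Aₖ}` a.e. -/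
def StableFun (μ : Measure Ω) (F : (Ω → X) → Ω → EReal) : Prop :=
  ∀ (xs : ℕ → Ω → X) (A : ℕ → Set Ω) (x : Ω → X),
    (∀ k, AEStronglyMeasurable (xs k) μ) → (∀ k, MeasurableSet (A k)) →
    Pairwise (Disjoint on A) → (⋃ k, A k) = Set.univ →
    (∀ᵐ ω ∂μ, ∀ k, ω ∈ A k → x ω = xs k ω) →
    ∀ᵐ ω ∂μ, ∀ k, ω ∈ A k → F x ω = F (xs k) ω

/-- `f : X → L̄⁰` is proper convex. -/
def ProperConvex (μ : Measure Ω) (f : X → Ω → EReal) : Prop :=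
  (∀ x : X, ∀ᵐ ω ∂μ, f x ω ≠ ⊥) ∧
  (∃ x' : X, ∀ᵐ ω ∂μ, f x' ω ≠ ⊥ ∧ f x' ω ≠ ⊤) ∧
  ∀ (x xt : X) (l : ℝ), 0 ≤ l → l ≤ 1 →
    ∀ᵐ ω ∂μ, f (l • x + (1 - l) • xt) ω ≤
      (l : EReal) * f x ω + ((1 - l : ℝ) : EReal) * f xt ω

/-- `F : L⁰(X) → L̄⁰` is L⁰-proper convex. -/
def L0ProperConvex (μ : Measure Ω) (F : (Ω → X) → Ω → EReal) : Prop :=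
  (∀ x : Ω → X, AEStronglyMeasurable x μ → ∀ᵐ ω ∂μ, F x ω ≠ ⊥) ∧
  (∃ x' : Ω → X, AEStronglyMeasurable x' μ ∧ ∀ᵐ ω ∂μ, F x' ω ≠ ⊥ ∧ F x' ω ≠ ⊤) ∧
  ∀ (x z : Ω → X) (l : Ω → ℝ), AEStronglyMeasurable x μ → AEStronglyMeasurable z μ →
    Measurable l → (∀ ω, 0 ≤ l ω ∧ l ω ≤ 1) →
    ∀ᵐ ω ∂μ, F (fun ω' => l ω' • x ω' + (1 - l ω') • z ω') ω ≤
      (l ω : EReal) * F x ω + ((1 - l ω : ℝ) : EReal) * F z ω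

/-- `U ⊆ L⁰(X)` is open in the stable topology `σ_s(L⁰(X), L⁰(Y))`: for every `x ∈ U`
there is a basic stable neighborhood `V ∈ 𝒱(x)` with `V ⊆ U`. -/
def SigmaSOpen (μ : Measure Ω) (B : X →ₗ[ℝ] Y →ₗ[ℝ] ℝ)
    (U : Set {x : Ω → X // AEStronglyMeasurable x μ}) : Prop :=
  ∀ x ∈ U, ∃ V : NbhdParam μ Y,
    ∀ z : {x : Ω → X // AEStronglyMeasurable x μ}, V.Mem B x.1 z.1 → z ∈ U

end Stable

section EssentialBounds

variable {Ω : Type*} [MeasurableSpace Ω] {μ : Measure Ω} {ι : Type*}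
  {g : ι → Ω → EReal} {s : Ω → EReal}

/-- A family of measurable functions is dominated a.e. by the supremum of a sequence from it. -/
lemma exists_seq_ae_le_iSup [SFinite μ] [Nonempty ι] (hg : ∀ i, AEMeasurable (g i) μ) :
    ∃ u : ℕ → ι, ∀ i, ∀ᵐ ω ∂μ, g i ω ≤ ⨆ n, g (u n) ω := by
  have levels : ∀ q : ℚ, ∃ u : ℕ → ι, ∀ i, ∀ᵐ ω ∂μ,
      ((q : ℝ) : EReal) < g i ω → ∃ n, ((q : ℝ) : EReal) < g (u n) ω := by
    intro q
    let S : ι → Set Ω := fun i => {ω | ((q : ℝ) : EReal) < (hg i).mk (g i) ω}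
    obtain ⟨D, hDS, hDc, hD⟩ := Measure.exists_ae_subset_biUnion_countable μ
      (C := range S) (by
        rintro _ ⟨i, rfl⟩
        exact measurableSet_lt measurable_const (hg i).measurable_mk)
    choose! idx hidx using fun t (ht : t ∈ D) => hDS ht
    obtain ⟨u, hu⟩ := ((hDc.image idx).insert (Classical.arbitrary ι)).exists_eq_range
      (insert_nonempty _ _)
    refine ⟨u, fun i => ?_⟩
    have hmk : ∀ᵐ ω ∂μ, ∀ n, g (u n) ω = (hg (u n)).mk (g (u n)) ω :=
      ae_all_iff.2 fun n => (hg (u n)).ae_eq_mk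
    filter_upwards [hD (S i) ⟨i, rfl⟩, (hg i).ae_eq_mk, hmk] with ω hω hi hn hlt
    obtain ⟨t, htD, hωt⟩ := hω (show ω ∈ S i by rw [hi] at hlt; exact hlt)
    obtain ⟨n, hnt⟩ : idx t ∈ range u := hu ▸ mem_insert_of_mem _ (mem_image_of_mem _ htD)
    refine ⟨n, ?_⟩
    rw [hn n, hnt]
    rw [← hidx t htD] at hωt
    exact hωt
  choose u hu using levels
  obtain ⟨e⟩ : Nonempty (ℕ ≃ ℚ × ℕ) := ⟨(Denumerable.eqv (ℚ × ℕ)).symm⟩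
  refine ⟨fun n => u (e n).1 (e n).2, fun i => ?_⟩
  filter_upwards [ae_all_iff.2 fun q => hu q i] with ω hω
  refine le_of_forall_lt fun c hc => ?_
  obtain ⟨q, hcq, hq⟩ := EReal.exists_rat_btwn_of_lt hc
  obtain ⟨n, hn⟩ := hω q hq
  refine hcq.trans (hn.trans_le ?_)
  have := le_iSup (fun n => g (u (e n).1 (e n).2) ω) (e.symm (q, n))
  simpa using this

lemma exists_seq_iInf_ae_le [SFinite μ] [Nonempty ι] (hg : ∀ i, AEMeasurable (g i) μ) :
    ∃ u : ℕ → ι, ∀ i, ∀ᵐ ω ∂μ, ⨅ n, g (u n) ω ≤ g i ω := by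
  obtain ⟨u, hu⟩ := exists_seq_ae_le_iSup (g := fun i ω => -g i ω) (fun i => (hg i).neg)
  refine ⟨u, fun i => ?_⟩
  filter_upwards [hu i] with ω hω
  refine EReal.neg_le_neg_iff.1 (hω.trans (iSup_le fun n => ?_))
  exact EReal.neg_le_neg_iff.2 (iInf_le _ n)

lemma exists_isAESup [SFinite μ] [Nonempty ι] (hg : ∀ i, AEMeasurable (g i) μ) :
    ∃ s, IsAESup μ g s := by
  obtain ⟨u, hu⟩ := exists_seq_ae_le_iSup hg
  have hm : AEMeasurable (fun ω => ⨆ n, g (u n) ω) μ := AEMeasurable.iSup fun n => hg (u n)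
  refine ⟨hm.mk _, hm.measurable_mk, fun i => ?_, fun h _ hh => ?_⟩
  · filter_upwards [hu i, hm.ae_eq_mk] with ω h1 h2
    exact h1.trans h2.le
  · filter_upwards [ae_all_iff.2 fun n => hh (u n), hm.ae_eq_mk] with ω h1 h2
    exact h2.symm.le.trans (iSup_le h1)

lemma exists_isAEInf [SFinite μ] [Nonempty ι] (hg : ∀ i, AEMeasurable (g i) μ) :
    ∃ s, IsAEInf μ g s := by
  obtain ⟨u, hu⟩ := exists_seq_iInf_ae_le hg
  have hm : AEMeasurable (fun ω => ⨅ n, g (u n) ω) μ := AEMeasurable.iInf fun n => hg (u n)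
  refine ⟨hm.mk _, hm.measurable_mk, fun i => ?_, fun h _ hh => ?_⟩
  · filter_upwards [hu i, hm.ae_eq_mk] with ω h1 h2
    exact h2.symm.le.trans h1
  · filter_upwards [ae_all_iff.2 fun n => hh (u n), hm.ae_eq_mk] with ω h1 h2
    exact (le_iInf h1).trans h2.le

lemma IsAESup.le_on (hs : IsAESup μ g s) {h : Ω → EReal} (hh : Measurable h) {A : Set Ω}
    (hA : MeasurableSet A) (hle : ∀ i, ∀ᵐ ω ∂μ, ω ∈ A → g i ω ≤ h ω) :
    ∀ᵐ ω ∂μ, ω ∈ A → s ω ≤ h ω := by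
  classical
  have := hs.2.2 (A.piecewise h fun _ => ⊤) (hh.piecewise hA measurable_const) fun i => by
    filter_upwards [hle i] with ω hω
    by_cases hωA : ω ∈ A <;> simp [hωA, hω]
  filter_upwards [this] with ω hω hωA
  simpa [hωA] using hω

lemma IsAEInf.le_on (hs : IsAEInf μ g s) {h : Ω → EReal} (hh : Measurable h) {A : Set Ω}
    (hA : MeasurableSet A) (hle : ∀ i, ∀ᵐ ω ∂μ, ω ∈ A → h ω ≤ g i ω) :
    ∀ᵐ ω ∂μ, ω ∈ A → h ω ≤ s ω := by
  classical
  have := hs.2.2 (A.piecewise h fun _ => ⊥) (hh.piecewise hA measurable_const) fun i => by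
    filter_upwards [hle i] with ω hω
    by_cases hωA : ω ∈ A <;> simp [hωA, hω]
  filter_upwards [this] with ω hω hωA
  simpa [hωA] using hω

lemma IsAEInf.exists_seq_lt [SFinite μ] [Nonempty ι] (hs : IsAEInf μ g s)
    (hg : ∀ i, AEMeasurable (g i) μ) :
    ∃ u : ℕ → ι, ∀ᵐ ω ∂μ, ∀ a, s ω < a → ∃ n, g (u n) ω < a := by
  obtain ⟨u, hu⟩ := exists_seq_iInf_ae_le hg
  have hm : AEMeasurable (fun ω => ⨅ n, g (u n) ω) μ := AEMeasurable.iInf fun n => hg (u n)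
  refine ⟨u, ?_⟩
  filter_upwards [hm.ae_eq_mk, hs.2.2 _ hm.measurable_mk fun i => by
    filter_upwards [hu i, hm.ae_eq_mk] with ω h1 h2
    exact h2.symm.le.trans h1] with ω h1 h2 a ha
  exact iInf_lt_iff.1 ((h1.le.trans h2).trans_lt ha)

lemma IsAESup.congr_ae {g' : ι → Ω → EReal} {s' : Ω → EReal}
    (hs : IsAESup μ g s) (hs' : IsAESup μ g' s') (h : ∀ i, g i =ᵐ[μ] g' i) : s =ᵐ[μ] s' := by
  have h1 := hs.2.2 s' hs'.1 fun i => (h i).le.trans (hs'.2.1 i)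
  have h2 := hs'.2.2 s hs.1 fun i => (h i).symm.le.trans (hs.2.1 i)
  filter_upwards [h1, h2] with ω h1 h2 using le_antisymm h1 h2

lemma IsAEInf.unique_ae {s' : Ω → EReal}
    (hs : IsAEInf μ g s) (hs' : IsAEInf μ g s') : s =ᵐ[μ] s' := by
  filter_upwards [hs'.2.2 s hs.1 hs.2.1, hs.2.2 s' hs'.1 hs'.2.1] with ω h1 h2
    using le_antisymm h1 h2

end EssentialBounds

section StepFunctions

variable {Ω : Type*} [MeasurableSpace Ω] {μ : Measure Ω} {X : Type*}

/-- A step function may be described by a measurable countably-valued index. -/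
lemma StepPair.of_index [Nonempty X] {ι : Type*} [Countable ι] [MeasurableSpace ι]
    [MeasurableSingletonClass ι] {f : X → Ω → EReal} {x : Ω → X} {g : Ω → EReal}
    (xs : ι → X) {κ : Ω → ι} (hκ : Measurable κ)
    (h : ∀ᵐ ω ∂μ, x ω = xs (κ ω) ∧ g ω = f (xs (κ ω)) ω) : StepPair μ f x g := by
  obtain ⟨e, he⟩ := exists_injective_nat ι
  have hem : Measurable fun ω => e (κ ω) := (measurable_of_countable e).comp hκ
  refine ⟨Function.extend e xs fun _ => Classical.arbitrary X, fun k => {ω | e (κ ω) = k},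
    fun k => hem (measurableSet_singleton k), ?_, ?_, ?_⟩
  · intro j k hjk
    exact disjoint_left.2 fun ω (hj : _ = j) (hk : _ = k) => hjk (hj.symm.trans hk)
  · exact eq_univ_of_forall fun ω => mem_iUnion.2 ⟨_, rfl⟩
  · filter_upwards [h] with ω hω k hk
    have hk : e (κ ω) = k := hk
    rw [← hk, he.extend_apply]
    exact hω

lemma StepPair.exists_index {f : X → Ω → EReal} {x : Ω → X} {g : Ω → EReal}
    (h : StepPair μ f x g) : ∃ (xs : ℕ → X) (κ : Ω → ℕ), Measurable κ ∧
      ∀ᵐ ω ∂μ, x ω = xs (κ ω) ∧ g ω = f (xs (κ ω)) ω := by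
  obtain ⟨xs, A, hA, hd, hU, h⟩ := h
  have hmem : ∀ ω, ∃ k, ω ∈ A k := fun ω => mem_iUnion.1 (hU ▸ mem_univ ω)
  choose κ hκ using hmem
  refine ⟨xs, κ, measurable_to_countable' fun k => ?_, ?_⟩
  · convert hA k using 1
    ext ω
    refine ⟨fun hk => (show κ ω = k from hk) ▸ hκ ω, fun hk => ?_⟩
    by_contra hne
    exact disjoint_left.1 (hd hne) (hκ ω) hk
  · filter_upwards [h] with ω hω
    exact hω _ (hκ ω)

lemma StepPair.isStep {f : X → Ω → EReal} {x : Ω → X} {g : Ω → EReal}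
    (h : StepPair μ f x g) : IsStep μ x := by
  obtain ⟨xs, A, hA, hd, hU, h⟩ := h
  exact ⟨xs, A, hA, hd, hU, h.mono fun ω hω k hk => (hω k hk).1⟩

lemma measurable_eval_index {β : Type*} [MeasurableSpace β] {h : ℕ → Ω → β}
    (hh : ∀ k, Measurable (h k)) {κ : Ω → ℕ} (hκ : Measurable κ) :
    Measurable fun ω => h (κ ω) ω := by
  have : Measurable fun p : ℕ × Ω => h p.1 p.2 := measurable_from_prod_countable_right hh
  exact this.comp (hκ.prodMk measurable_id)

lemma StepPair.aemeasurable {f : X → Ω → EReal} (hf : ∀ x, Measurable (f x)) {x : Ω → X}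
    {g : Ω → EReal} (h : StepPair μ f x g) : AEMeasurable g μ := by
  obtain ⟨xs, κ, hκ, h⟩ := h.exists_index
  exact ⟨_, measurable_eval_index (fun k => hf (xs k)) hκ, h.mono fun ω hω => hω.2⟩

/-- Two step functions may be pasted along a measurable set. -/
lemma StepPair.piecewise [Nonempty X] {f : X → Ω → EReal} {x z : Ω → X} {g h : Ω → EReal}
    (hx : StepPair μ f x g) (hz : StepPair μ f z h) {A : Set Ω} (hA : MeasurableSet A)
    [∀ ω, Decidable (ω ∈ A)] : StepPair μ f (A.piecewise x z) (A.piecewise g h) := by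
  obtain ⟨xs, κ, hκ, hx⟩ := hx.exists_index
  obtain ⟨zs, κ', hκ', hz⟩ := hz.exists_index
  refine StepPair.of_index (fun p : Bool × ℕ => if p.1 then xs p.2 else zs p.2)
    (κ := A.piecewise (fun ω => (true, κ ω)) fun ω => (false, κ' ω))
    ((measurable_const.prodMk hκ).piecewise hA (measurable_const.prodMk hκ')) ?_
  filter_upwards [hx, hz] with ω h1 h2
  by_cases hω : ω ∈ A <;> simp [hω, h1, h2]

/-- Strongly measurable functions are uniformly approximated by step functions. -/
lemma exists_index_dist_lt {E : Type*} [PseudoMetricSpace E] [Nonempty E] {x : Ω → E}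
    (hx : StronglyMeasurable x) {ε : Ω → ℝ} (hε : Measurable ε) (hpos : ∀ ω, 0 < ε ω) :
    ∃ (es : ℕ → E) (κ : Ω → ℕ), Measurable κ ∧ ∀ ω, dist (es (κ ω)) (x ω) < ε ω := by
  classical
  obtain ⟨c, hc, hxc⟩ := hx.isSeparable_range
  obtain ⟨es, hes⟩ := (hc.insert (Classical.arbitrary E)).exists_eq_range (insert_nonempty _ _)
  have hex : ∀ ω, ∃ k, dist (es k) (x ω) < ε ω := by
    intro ω
    obtain ⟨b, hb, hbd⟩ := Metric.mem_closure_iff.1 (hxc ⟨ω, rfl⟩) (ε ω) (hpos ω)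
    obtain ⟨k, rfl⟩ : b ∈ range es := hes ▸ mem_insert_of_mem _ hb
    exact ⟨k, by rwa [dist_comm]⟩
  refine ⟨es, fun ω => Nat.find (hex ω), measurable_find hex fun k => ?_,
    fun ω => Nat.find_spec (hex ω)⟩
  exact measurableSet_lt (stronglyMeasurable_const.dist hx).measurable hε

end StepFunctions

section Neighborhoods

variable {Ω : Type*} [MeasurableSpace Ω] {μ : Measure Ω}
  {X Y : Type*} [NormedAddCommGroup X] [NormedSpace ℝ X]
  [NormedAddCommGroup Y] [NormedSpace ℝ Y] {B : X →ₗ[ℝ] Y →ₗ[ℝ] ℝ}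

instance : Nonempty (NbhdParam μ Y) :=
  ⟨{ r := fun _ => 1
     r_meas := measurable_const
     r_pos := fun _ => one_pos
     n := fun _ => 0
     n_meas := measurable_const
     ys := fun _ _ => 0
     ys_meas := fun _ => aestronglyMeasurable_const }⟩

/-- The neighborhood with the same functionals and half the radius. -/
def NbhdParam.half (V : NbhdParam μ Y) : NbhdParam μ Y where
  __ := V
  r := fun ω => V.r ω / 2
  r_meas := V.r_meas.div_const 2
  r_pos := fun ω => half_pos (V.r_pos ω)

lemma NbhdParam.Mem.of_half {V : NbhdParam μ Y} {x z t : Ω → X}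
    (hxz : V.half.Mem B x z) (hzt : V.half.Mem B z t) : V.Mem B x t := by
  filter_upwards [hxz, hzt] with ω h1 h2 m hm hmn
  have h1 : |B (z ω - x ω) (V.ys m ω)| ≤ V.r ω / 2 := h1 m hm hmn
  have h2 : |B (t ω - z ω) (V.ys m ω)| ≤ V.r ω / 2 := h2 m hm hmn
  have : B (t ω - x ω) (V.ys m ω) = B (t ω - z ω) (V.ys m ω) + B (z ω - x ω) (V.ys m ω) := by
    simp
  rw [this]
  exact (abs_add_le _ _).trans (by linarith)

lemma NbhdParam.Mem.refl (V : NbhdParam μ Y) (x : Ω → X) : V.Mem B x x :=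
  ae_of_all _ fun ω m _ _ => by simpa using (V.r_pos ω).le

lemma NbhdParam.Mem.piecewise {V : NbhdParam μ Y} {x z t t' : Ω → X} {A : Set Ω}
    [∀ ω, Decidable (ω ∈ A)] (hxz : ∀ᵐ ω ∂μ, ω ∈ A → x ω = z ω)
    (hz : V.Mem B z t) (hx : V.Mem B x t') : V.Mem B x (A.piecewise t t') := by
  filter_upwards [hxz, hz, hx] with ω h h1 h2
  by_cases hω : ω ∈ A
  · simpa [hω, h hω] using h1
  · simpa [hω] using h2

/-- A stable neighborhood contains a norm ball of measurable positive radius. -/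
lemma NbhdParam.exists_norm_radius (hB : ∀ (x : X) (y : Y), |B x y| ≤ ‖x‖ * ‖y‖)
    (V : NbhdParam μ Y) : ∃ δ : Ω → ℝ, Measurable δ ∧ (∀ ω, 0 < δ ω) ∧
      ∀ᵐ ω ∂μ, ∀ v : X, ‖v‖ ≤ δ ω → ∀ m ≤ V.n ω, |B v (V.ys m ω)| ≤ V.r ω := by
  let y : ℕ → Ω → Y := fun m => (V.ys_meas m).mk (V.ys m)
  have hy : ∀ m, StronglyMeasurable (y m) := fun m => (V.ys_meas m).stronglyMeasurable_mk
  let T : Ω → ℝ := fun ω => ∑ m ∈ Finset.range (V.n ω + 1), ‖y m ω‖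
  have hT : Measurable T :=
    measurable_eval_index (h := fun n ω => ∑ m ∈ Finset.range (n + 1), ‖y m ω‖)
      (fun n => Finset.measurable_fun_sum _ fun m _ => (hy m).norm.measurable) V.n_meas
  have hT0 : ∀ ω, 0 ≤ T ω := fun ω => Finset.sum_nonneg fun m _ => norm_nonneg _
  refine ⟨fun ω => V.r ω / (1 + T ω), V.r_meas.div (hT.const_add 1),
    fun ω => div_pos (V.r_pos ω) (by linarith [hT0 ω]), ?_⟩
  filter_upwards [ae_all_iff.2 fun m => (V.ys_meas m).ae_eq_mk] with ω hω v hv m hm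
  have hym : ‖V.ys m ω‖ ≤ 1 + T ω := by
    have : ‖y m ω‖ ≤ T ω := Finset.single_le_sum (f := fun m => ‖y m ω‖)
      (fun m _ => norm_nonneg _) (Finset.mem_range.2 (Nat.lt_succ_of_le hm))
    rw [hω m]
    linarith
  calc |B v (V.ys m ω)| ≤ ‖v‖ * ‖V.ys m ω‖ := hB _ _
    _ ≤ V.r ω / (1 + T ω) * (1 + T ω) :=
      mul_le_mul hv hym (norm_nonneg _) ((norm_nonneg _).trans hv)
    _ = V.r ω := div_mul_cancel₀ _ (by linarith [hT0 ω])

/-- Step functions together with their images under `f_s`, within a stable neighborhood. -/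
abbrev StepsNear (B : X →ₗ[ℝ] Y →ₗ[ℝ] ℝ) (f : X → Ω → EReal) (V : NbhdParam μ Y)
    (x : Ω → X) : Type _ :=
  {p : (Ω → X) × (Ω → EReal) // StepPair μ f p.1 p.2 ∧ V.Mem B x p.1}

lemma nonempty_stepsNear (hB : ∀ (x : X) (y : Y), |B x y| ≤ ‖x‖ * ‖y‖) (f : X → Ω → EReal)
    (V : NbhdParam μ Y) {x : Ω → X} (hx : AEStronglyMeasurable x μ) :
    Nonempty (StepsNear B f V x) := by
  obtain ⟨δ, hδ, hδ0, hV⟩ := V.exists_norm_radius hB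
  obtain ⟨xs, κ, hκ, hd⟩ := exists_index_dist_lt hx.stronglyMeasurable_mk hδ hδ0
  refine ⟨⟨(fun ω => xs (κ ω), fun ω => f (xs (κ ω)) ω),
    StepPair.of_index xs hκ (ae_of_all _ fun ω => ⟨rfl, rfl⟩), ?_⟩⟩
  filter_upwards [hV, hx.ae_eq_mk] with ω hω h m _ hm
  exact hω _ (by rw [h, ← dist_eq_norm]; exact (hd ω).le) m hm

end Neighborhoods

section CanonicalExtension

variable {Ω : Type*} [MeasurableSpace Ω] {μ : Measure Ω}
  {X Y : Type*} [NormedAddCommGroup X] [NormedSpace ℝ X]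
  [NormedAddCommGroup Y] [NormedSpace ℝ Y] {B : X →ₗ[ℝ] Y →ₗ[ℝ] ℝ}
  {f : X → Ω → EReal} {F : (Ω → X) → Ω → EReal}

lemma exists_isCanonicalExt [SFinite μ] (hB : ∀ (x : X) (y : Y), |B x y| ≤ ‖x‖ * ‖y‖)
    (hf : ∀ x, Measurable (f x)) : ∃ F, IsCanonicalExt μ B f F := by
  have : ∀ x : Ω → X, ∃ s : Ω → EReal, AEStronglyMeasurable x μ →
      ∃ I : NbhdParam μ Y → Ω → EReal,
        (∀ V, IsAEInf μ (fun p : StepsNear B f V x => p.1.2) (I V)) ∧ IsAESup μ I s := by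
    intro x
    by_cases hx : AEStronglyMeasurable x μ
    · have hI : ∀ V : NbhdParam μ Y, ∃ s,
          IsAEInf μ (fun p : StepsNear B f V x => p.1.2) s := fun V =>
        have := nonempty_stepsNear hB f V hx
        exists_isAEInf fun p => p.2.1.aemeasurable hf
      choose I hI using hI
      obtain ⟨s, hs⟩ := exists_isAESup fun V => (hI V).1.aemeasurable (μ := μ)
      exact ⟨s, fun _ => ⟨I, hI, hs⟩⟩
    · exact ⟨⊤, fun h => absurd h hx⟩
  choose F hF using this
  exact ⟨F, hF⟩

lemma IsCanonicalExt.ae_eq_of_lsc (hF : IsCanonicalExt μ B f F) (hlsc : SigmaSLsc μ B f) (x : X) :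
    F (fun _ => x) =ᵐ[μ] f x := by
  obtain ⟨I, hI, hs⟩ := hF (fun _ => x) aestronglyMeasurable_const
  obtain ⟨I', hI', hs'⟩ := hlsc x
  exact hs.congr_ae hs' fun V => (hI V).unique_ae (hI' V)

lemma IsCanonicalExt.measurable (hF : IsCanonicalExt μ B f F) {x : Ω → X}
    (hx : AEStronglyMeasurable x μ) : Measurable (F x) := by
  obtain ⟨I, _, hs⟩ := hF x hx
  exact hs.1

lemma IsCanonicalExt.le_of_eq_on (hB : ∀ (x : X) (y : Y), |B x y| ≤ ‖x‖ * ‖y‖)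
    (hF : IsCanonicalExt μ B f F) {x z : Ω → X} (hx : AEStronglyMeasurable x μ)
    (hz : AEStronglyMeasurable z μ) {A : Set Ω} (hA : MeasurableSet A)
    (h : ∀ᵐ ω ∂μ, ω ∈ A → x ω = z ω) : ∀ᵐ ω ∂μ, ω ∈ A → F x ω ≤ F z ω := by
  classical
  obtain ⟨I, hI, hs⟩ := hF x hx
  obtain ⟨J, hJ, ht⟩ := hF z hz
  refine hs.le_on ht.1 hA fun V => ?_
  have hIJ : ∀ᵐ ω ∂μ, ω ∈ A → I V ω ≤ J V ω := by
    refine (hJ V).le_on (hI V).1 hA fun p => ?_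
    obtain ⟨q⟩ := nonempty_stepsNear hB f V hx
    filter_upwards [(hI V).2.1 ⟨(A.piecewise p.1.1 q.1.1, A.piecewise p.1.2 q.1.2),
      p.2.1.piecewise q.2.1 hA, NbhdParam.Mem.piecewise h p.2.2 q.2.2⟩] with ω hω hωA
    simpa [hωA] using hω
  filter_upwards [hIJ, ht.2.1 V] with ω h1 h2 hω using (h1 hω).trans h2

/-- The canonical extension is local. -/
lemma IsCanonicalExt.eq_of_eq_on (hB : ∀ (x : X) (y : Y), |B x y| ≤ ‖x‖ * ‖y‖)
    (hF : IsCanonicalExt μ B f F) {x z : Ω → X} (hx : AEStronglyMeasurable x μ)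
    (hz : AEStronglyMeasurable z μ) {A : Set Ω} (hA : MeasurableSet A)
    (h : ∀ᵐ ω ∂μ, ω ∈ A → x ω = z ω) : ∀ᵐ ω ∂μ, ω ∈ A → F x ω = F z ω := by
  filter_upwards [hF.le_of_eq_on hB hx hz hA h,
    hF.le_of_eq_on hB hz hx hA (h.mono fun ω hω hωA => (hω hωA).symm)] with ω h1 h2 hω
  exact le_antisymm (h1 hω) (h2 hω)

lemma IsCanonicalExt.stableFun (hB : ∀ (x : X) (y : Y), |B x y| ≤ ‖x‖ * ‖y‖)
    (hF : IsCanonicalExt μ B f F) : StableFun μ F := by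
  intro xs A x hxs hA hd hU h
  have hx : AEStronglyMeasurable x μ := by
    rw [← Measure.restrict_univ (μ := μ), ← hU, aestronglyMeasurable_iUnion_iff]
    intro k
    refine (hxs k).restrict.congr ?_
    rw [Filter.EventuallyEq, ae_restrict_iff' (hA k)]
    exact h.mono fun ω hω hk => (hω k hk).symm
  exact ae_all_iff.2 fun k =>
    hF.eq_of_eq_on hB hx (hxs k) (hA k) (h.mono fun ω hω => hω k)

lemma IsCanonicalExt.sigmaSLscL0 [SFinite μ] (hF : IsCanonicalExt μ B f F) :
    SigmaSLscL0 μ B F := by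
  intro x hx
  have hJ : ∀ V : NbhdParam μ Y, ∃ s, IsAEInf μ
      (fun z : {z : Ω → X // AEStronglyMeasurable z μ ∧ V.Mem B x z} => F z.1) s := fun V =>
    have : Nonempty {z : Ω → X // AEStronglyMeasurable z μ ∧ V.Mem B x z} :=
      ⟨⟨x, hx, NbhdParam.Mem.refl V x⟩⟩
    exists_isAEInf fun z => (hF.measurable z.2.1).aemeasurable
  choose J hJ using hJ
  refine ⟨J, hJ, hF.measurable hx, fun V => (hJ V).2.1 ⟨x, hx, NbhdParam.Mem.refl V x⟩,
    fun h hh hle => ?_⟩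
  obtain ⟨I, hI, hs⟩ := hF x hx
  refine hs.2.2 h hh fun V => ?_
  have hIJ : ∀ᵐ ω ∂μ, I V ω ≤ J V.half ω := by
    refine (hJ V.half).2.2 _ (hI V).1 fun z => ?_
    obtain ⟨K, hK, ht⟩ := hF z.1 z.2.1
    have hIK : ∀ᵐ ω ∂μ, I V ω ≤ K V.half ω :=
      (hK V.half).2.2 _ (hI V).1 fun p => (hI V).2.1 ⟨p.1, p.2.1, z.2.2.of_half p.2.2⟩
    filter_upwards [hIK, ht.2.1 V.half] with ω h1 h2 using h1.trans h2
  filter_upwards [hIJ, hle V.half] with ω h1 h2 using h1.trans h2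

/-- Convex combinations of step functions with step weights. -/
lemma StepPair.exists_convexCombination
    (hconv : ∀ (x z : X) (l : ℝ), 0 ≤ l → l ≤ 1 → ∀ᵐ ω ∂μ,
      f (l • x + (1 - l) • z) ω ≤ (l : EReal) * f x ω + ((1 - l : ℝ) : EReal) * f z ω)
    {x z : Ω → X} {g h : Ω → EReal} (hx : StepPair μ f x g) (hz : StepPair μ f z h)
    (ls : ℕ → Icc (0 : ℝ) 1) {ν : Ω → ℕ} (hν : Measurable ν) :
    ∃ k : Ω → EReal,
      StepPair μ f (fun ω => (ls (ν ω) : ℝ) • x ω + (1 - (ls (ν ω) : ℝ)) • z ω) k ∧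
      ∀ᵐ ω ∂μ, k ω ≤ ((ls (ν ω) : ℝ) : EReal) * g ω
        + ((1 - (ls (ν ω) : ℝ) : ℝ) : EReal) * h ω := by
  obtain ⟨xs, κ, hκ, hx⟩ := hx.exists_index
  obtain ⟨zs, κ', hκ', hz⟩ := hz.exists_index
  let c : ℕ × ℕ × ℕ → X := fun p => (ls p.1 : ℝ) • xs p.2.1 + (1 - (ls p.1 : ℝ)) • zs p.2.2
  refine ⟨fun ω => f (c (ν ω, κ ω, κ' ω)) ω,
    StepPair.of_index c (hν.prodMk (hκ.prodMk hκ')) ?_, ?_⟩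
  · filter_upwards [hx, hz] with ω h1 h2
    simp [c, h1.1, h2.1]
  · have : ∀ᵐ ω ∂μ, ∀ p : ℕ × ℕ × ℕ, f (c p) ω ≤ ((ls p.1 : ℝ) : EReal) * f (xs p.2.1) ω
        + ((1 - (ls p.1 : ℝ) : ℝ) : EReal) * f (zs p.2.2) ω :=
      ae_all_iff.2 fun p => hconv _ _ _ (ls p.1).2.1 (ls p.1).2.2
    filter_upwards [hx, hz, this] with ω h1 h2 h3
    rw [h1.2, h2.2]
    exact h3 _

lemma abs_pairing_combination_le {t s u v : X} {y : Y} {l c r : ℝ} (hl0 : 0 ≤ l)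
    (hl1 : l ≤ 1) (ht : |B (t - u) y| ≤ r / 2) (hs : |B (s - v) y| ≤ r / 2)
    (hc : |B ((l - c) • (u - v)) y| ≤ r / 2) :
    |B (l • t + (1 - l) • s - (c • u + (1 - c) • v)) y| ≤ r := by
  have : l • t + (1 - l) • s - (c • u + (1 - c) • v)
      = l • (t - u) + (1 - l) • (s - v) + (l - c) • (u - v) := by module
  rw [this]
  simp only [map_add, LinearMap.add_apply]
  simp only [map_smul, LinearMap.smul_apply, smul_eq_mul] at hc ⊢
  rw [abs_le] at *
  constructor <;> nlinarith

lemma IsCanonicalExt.convexCombination_le [SFinite μ]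
    (hB : ∀ (x : X) (y : Y), |B x y| ≤ ‖x‖ * ‖y‖) (hf : ∀ x, Measurable (f x))
    (hF : IsCanonicalExt μ B f F)
    (hconv : ∀ (x z : X) (l : ℝ), 0 ≤ l → l ≤ 1 → ∀ᵐ ω ∂μ,
      f (l • x + (1 - l) • z) ω ≤ (l : EReal) * f x ω + ((1 - l : ℝ) : EReal) * f z ω)
    {x z : Ω → X} (hx : AEStronglyMeasurable x μ) (hz : AEStronglyMeasurable z μ)
    {l : Ω → ℝ} (hl : Measurable l) (hl01 : ∀ ω, 0 ≤ l ω ∧ l ω ≤ 1) (a b : ℝ) :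
    ∀ᵐ ω ∂μ, F x ω < a → F z ω < b →
      F (fun ω' => l ω' • x ω' + (1 - l ω') • z ω') ω
        ≤ ((l ω * a + (1 - l ω) * b : ℝ) : EReal) := by
  have hw : AEStronglyMeasurable (fun ω' => l ω' • x ω' + (1 - l ω') • z ω') μ :=
    (hl.aestronglyMeasurable.smul hx).add ((hl.const_sub 1).aestronglyMeasurable.smul hz)
  obtain ⟨I, hI, hs⟩ := hF _ hw
  obtain ⟨J, hJ, hsx⟩ := hF x hx
  obtain ⟨K, hK, hsz⟩ := hF z hz
  have hA : MeasurableSet ({ω | F x ω < a} ∩ {ω | F z ω < b}) :=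
    (measurableSet_lt hsx.1 measurable_const).inter (measurableSet_lt hsz.1 measurable_const)
  have hbound : Measurable fun ω => ((l ω * a + (1 - l ω) * b : ℝ) : EReal) :=
    ((hl.mul_const a).add ((hl.const_sub 1).mul_const b)).coe_real_ereal
  suffices ∀ᵐ ω ∂μ, ω ∈ {ω | F x ω < a} ∩ {ω | F z ω < b} →
      F (fun ω' => l ω' • x ω' + (1 - l ω') • z ω') ω
        ≤ ((l ω * a + (1 - l ω) * b : ℝ) : EReal) from
    this.mono fun ω hω h1 h2 => hω ⟨h1, h2⟩
  refine hs.le_on hbound hA fun V => ?_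
  have approx : ∀ n : ℕ, ∀ᵐ ω ∂μ, ω ∈ {ω | F x ω < a} ∩ {ω | F z ω < b} →
      I V ω ≤ ((l ω * a + (1 - l ω) * b + |a - b| * (1 / ((n : ℝ) + 1)) : ℝ) : EReal) := by
    intro n
    obtain ⟨δ, hδ, hδ0, hδV⟩ := V.half.exists_norm_radius hB
    have hN : Measurable fun ω => 1 + ‖hx.mk x ω - hz.mk z ω‖ :=
      ((hx.stronglyMeasurable_mk.sub hz.stronglyMeasurable_mk).norm.measurable).const_add 1
    have hN0 : ∀ ω, 0 < 1 + ‖hx.mk x ω - hz.mk z ω‖ := fun ω => by positivity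
    obtain ⟨ls, ν, hν, hd⟩ := exists_index_dist_lt
      (x := fun ω => (⟨l ω, hl01 ω⟩ : Icc (0 : ℝ) 1)) (hl.subtype_mk).stronglyMeasurable
      (ε := fun ω => min (1 / ((n : ℝ) + 1)) (δ ω / (1 + ‖hx.mk x ω - hz.mk z ω‖)))
      (measurable_const.min (hδ.div hN))
      (fun ω => lt_min Nat.one_div_pos_of_nat (div_pos (hδ0 ω) (hN0 ω)))
    have := nonempty_stepsNear hB f V.half hx
    have := nonempty_stepsNear hB f V.half hz
    obtain ⟨u, hu⟩ := (hJ V.half).exists_seq_lt fun p => p.2.1.aemeasurable hf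
    obtain ⟨v, hv⟩ := (hK V.half).exists_seq_lt fun p => p.2.1.aemeasurable hf
    choose k hk hkle using fun i j =>
      (u i).2.1.exists_convexCombination hconv (v j).2.1 ls hν
    have hmem : ∀ i j, V.Mem B (fun ω' => l ω' • x ω' + (1 - l ω') • z ω') (fun ω =>
        (ls (ν ω) : ℝ) • (u i).1.1 ω + (1 - (ls (ν ω) : ℝ)) • (v j).1.1 ω) := by
      intro i j
      filter_upwards [(u i).2.2, (v j).2.2, hδV, hx.ae_eq_mk, hz.ae_eq_mk]
        with ω h1 h2 h3 hxω hzω m hm hmn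
      refine abs_pairing_combination_le (ls (ν ω)).2.1 (ls (ν ω)).2.2 (h1 m hm hmn)
        (h2 m hm hmn) (h3 _ ?_ m hmn)
      have hlt := (hd ω).trans_le (min_le_right _ _)
      rw [lt_div_iff₀ (hN0 ω), Subtype.dist_eq, Real.dist_eq, ← hxω, ← hzω] at hlt
      rw [norm_smul, Real.norm_eq_abs]
      exact (mul_le_mul_of_nonneg_left (by linarith) (abs_nonneg _)).trans hlt.le
    have hIk : ∀ᵐ ω ∂μ, ∀ i j, I V ω ≤ k i j ω := ae_all_iff.2 fun i => ae_all_iff.2 fun j =>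
      (hI V).2.1 ⟨(_, k i j), hk i j, hmem i j⟩
    filter_upwards [hu, hv, hIk, ae_all_iff.2 fun i => ae_all_iff.2 fun j => hkle i j,
      hsx.2.1 V.half, hsz.2.1 V.half] with ω hu hv hIk hkle hJx hKz hω
    obtain ⟨i, hi⟩ := hu a (hJx.trans_lt hω.1)
    obtain ⟨j, hj⟩ := hv b (hKz.trans_lt hω.2)
    have h0 := (ls (ν ω)).2.1
    have h1 := (ls (ν ω)).2.2
    calc I V ω ≤ k i j ω := hIk i j
      _ ≤ _ := hkle i j
      _ ≤ ((ls (ν ω) : ℝ) : EReal) * (a : EReal)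
          + ((1 - (ls (ν ω) : ℝ) : ℝ) : EReal) * (b : EReal) :=
        add_le_add (mul_le_mul_of_nonneg_left hi.le (EReal.coe_nonneg.2 h0))
          (mul_le_mul_of_nonneg_left hj.le (EReal.coe_nonneg.2 (by linarith)))
      _ = (((ls (ν ω) : ℝ) * a + (1 - (ls (ν ω) : ℝ)) * b : ℝ) : EReal) := by push_cast; rfl
      _ ≤ _ := by
        refine EReal.coe_le_coe_iff.2 ?_
        have hlt := (hd ω).trans_le (min_le_left _ _)
        rw [Subtype.dist_eq, Real.dist_eq] at hlt
        have hab : ((ls (ν ω) : ℝ) - l ω) * (a - b) ≤ |a - b| * (1 / ((n : ℝ) + 1)) := by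
          refine (le_abs_self _).trans ?_
          rw [abs_mul, mul_comm]
          exact mul_le_mul_of_nonneg_left hlt.le (abs_nonneg _)
        linarith
  filter_upwards [ae_all_iff.2 approx] with ω hω hωA
  have hlim : Tendsto (fun n : ℕ =>
      ((l ω * a + (1 - l ω) * b + |a - b| * (1 / ((n : ℝ) + 1)) : ℝ) : EReal)) atTop
      (𝓝 ((l ω * a + (1 - l ω) * b : ℝ) : EReal)) := by
    refine (continuous_coe_real_ereal.tendsto _).comp ?_
    simpa using ((tendsto_one_div_add_atTop_nhds_zero_nat (𝕜 := ℝ)).const_mul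
      |a - b|).const_add (l ω * a + (1 - l ω) * b)
  exact ge_of_tendsto' hlim fun n => hω n hωA

lemma IsCanonicalExt.ne_bot [SFinite μ]
    (hB : ∀ (x : X) (y : Y), |B x y| ≤ ‖x‖ * ‖y‖) (hf : ∀ x, Measurable (f x))
    (hF : IsCanonicalExt μ B f F)
    (hconv : ∀ (x z : X) (l : ℝ), 0 ≤ l → l ≤ 1 → ∀ᵐ ω ∂μ,
      f (l • x + (1 - l) • z) ω ≤ (l : EReal) * f x ω + ((1 - l : ℝ) : EReal) * f z ω)
    {x z : Ω → X} (hx : AEStronglyMeasurable x μ) (hz : AEStronglyMeasurable z μ)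
    (hFz : ∀ᵐ ω ∂μ, F z ω ≠ ⊥ ∧ F z ω ≠ ⊤) : ∀ᵐ ω ∂μ, F x ω ≠ ⊥ := by
  obtain ⟨J, hJ, hs⟩ := hF.sigmaSLscL0 z hz
  have hA : MeasurableSet {ω | F x ω = ⊥} := hF.measurable hx (measurableSet_singleton ⊥)
  suffices ∀ᵐ ω ∂μ, ω ∈ {ω | F x ω = ⊥} → F z ω ≤ ⊥ by
    filter_upwards [this, hFz] with ω h1 h2 h3
    exact h2.1 (le_bot_iff.1 (h1 h3))
  refine hs.le_on measurable_const hA fun V => ?_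
  obtain ⟨δ, hδ, hδ0, hδV⟩ := V.exists_norm_radius hB
  have hN0 : ∀ ω, 0 < 1 + ‖hx.mk x ω - hz.mk z ω‖ := fun ω => by positivity
  let l : Ω → ℝ := fun ω => min 1 (δ ω / (1 + ‖hx.mk x ω - hz.mk z ω‖))
  have hl : Measurable l := measurable_const.min (hδ.div
    ((hx.stronglyMeasurable_mk.sub hz.stronglyMeasurable_mk).norm.measurable.const_add 1))
  have hl0 : ∀ ω, 0 < l ω := fun ω => lt_min one_pos (div_pos (hδ0 ω) (hN0 ω))
  have hw : AEStronglyMeasurable (fun ω' => l ω' • x ω' + (1 - l ω') • z ω') μ :=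
    (hl.aestronglyMeasurable.smul hx).add ((hl.const_sub 1).aestronglyMeasurable.smul hz)
  have hmem : V.Mem B z (fun ω' => l ω' • x ω' + (1 - l ω') • z ω') := by
    filter_upwards [hδV, hx.ae_eq_mk, hz.ae_eq_mk] with ω h hxω hzω m _ hmn
    refine h _ ?_ m hmn
    have : l ω • x ω + (1 - l ω) • z ω - z ω = l ω • (x ω - z ω) := by module
    rw [this, norm_smul, Real.norm_eq_abs, abs_of_pos (hl0 ω)]
    have hle : l ω ≤ _ := min_le_right _ _
    rw [le_div_iff₀ (hN0 ω), ← hxω, ← hzω] at hle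
    nlinarith [hl0 ω]
  filter_upwards [(hJ V).2.1 ⟨_, hw, hmem⟩, hFz, ae_all_iff.2 fun a : ℚ => ae_all_iff.2
    fun b : ℚ => hF.convexCombination_le hB hf hconv hx hz hl
      (fun ω => ⟨(hl0 ω).le, min_le_left _ _⟩) a b] with ω hJω hzω hcomb hbot
  refine hJω.trans (le_bot_iff.2 ((EReal.eq_bot_iff_forall_lt _).2 fun c => ?_))
  obtain ⟨b, hb, -⟩ := EReal.exists_rat_btwn_of_lt (lt_top_iff_ne_top.2 hzω.2)
  obtain ⟨a, ha⟩ := exists_rat_lt ((c - (1 - l ω) * b) / l ω)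
  refine (hcomb a b (by rw [show F x ω = ⊥ from hbot]; exact EReal.bot_lt_coe _) hb).trans_lt
    (EReal.coe_lt_coe_iff.2 ?_)
  rw [lt_div_iff₀ (hl0 ω)] at ha
  linarith

lemma IsCanonicalExt.l0ProperConvex [SFinite μ]
    (hB : ∀ (x : X) (y : Y), |B x y| ≤ ‖x‖ * ‖y‖) (hf : ∀ x, Measurable (f x))
    (hF : IsCanonicalExt μ B f F) (hext : ∀ x, F (fun _ => x) =ᵐ[μ] f x)
    (hprop : ProperConvex μ f) : L0ProperConvex μ F := by
  obtain ⟨-, ⟨x', hx'⟩, hconv⟩ := hprop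
  have hFx' : ∀ᵐ ω ∂μ, F (fun _ => x') ω ≠ ⊥ ∧ F (fun _ => x') ω ≠ ⊤ := by
    filter_upwards [hx', hext x'] with ω h1 h2
    rwa [h2]
  have hbot : ∀ x : Ω → X, AEStronglyMeasurable x μ → ∀ᵐ ω ∂μ, F x ω ≠ ⊥ := fun x hx =>
    hF.ne_bot hB hf hconv hx aestronglyMeasurable_const hFx'
  refine ⟨hbot, ⟨_, aestronglyMeasurable_const, hFx'⟩, fun x z l hx hz hl hl01 => ?_⟩
  have hw : AEStronglyMeasurable (fun ω' => l ω' • x ω' + (1 - l ω') • z ω') μ :=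
    (hl.aestronglyMeasurable.smul hx).add ((hl.const_sub 1).aestronglyMeasurable.smul hz)
  have hzero := hF.eq_of_eq_on hB hw hz (hl (measurableSet_singleton 0))
    (ae_of_all _ fun ω (hω : l ω = 0) => by simp [hω])
  have hone := hF.eq_of_eq_on hB hw hx (hl (measurableSet_singleton 1))
    (ae_of_all _ fun ω (hω : l ω = 1) => by simp [hω])
  filter_upwards [hbot x hx, hbot z hz, hzero, hone, ae_all_iff.2 fun a : ℚ => ae_all_iff.2
    fun b : ℚ => hF.convexCombination_le hB hf hconv hx hz hl hl01 a b]
    with ω hxb hzb hzero hone hcomb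
  rcases (hl01 ω).1.eq_or_lt with h0 | h0
  · rw [hzero h0.symm, ← h0]
    simp
  rcases (hl01 ω).2.eq_or_lt with h1 | h1
  · rw [hone h1, h1]
    simp
  have h1' : 0 < 1 - l ω := sub_pos.2 h1
  generalize F (fun ω' => l ω' • x ω' + (1 - l ω') • z ω') ω = W at *
  generalize F x ω = α at *
  generalize F z ω = β at *
  induction α with
  | bot => exact absurd rfl hxb
  | top =>
    rw [EReal.coe_mul_top_of_pos h0, EReal.top_add_of_ne_bot]
    · exact le_top
    · induction β with
      | bot => exact absurd rfl hzb
      | top => rw [EReal.coe_mul_top_of_pos h1']; exact top_ne_bot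
      | coe β => rw [← EReal.coe_mul]; exact EReal.coe_ne_bot _
  | coe α =>
    induction β with
    | bot => exact absurd rfl hzb
    | top =>
      rw [EReal.coe_mul_top_of_pos h1', ← EReal.coe_mul, EReal.coe_add_top]
      exact le_top
    | coe β =>
      rw [← EReal.coe_mul, ← EReal.coe_mul, ← EReal.coe_add]
      refine EReal.le_of_forall_lt_iff_le.1 fun c hc => ?_
      have hc := EReal.coe_lt_coe_iff.1 hc
      set ε := c - (l ω * α + (1 - l ω) * β) with hε
      have hε0 : 0 < ε := sub_pos.2 hc
      obtain ⟨a, ha, ha'⟩ := exists_rat_btwn (lt_add_of_pos_right α hε0)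
      obtain ⟨b, hb, hb'⟩ := exists_rat_btwn (lt_add_of_pos_right β hε0)
      refine (hcomb a b (EReal.coe_lt_coe_iff.2 ha) (EReal.coe_lt_coe_iff.2 hb)).trans
        (EReal.coe_le_coe_iff.2 ?_)
      nlinarith

end CanonicalExtension

/-- **Extension theorem.** If `f : X → L̄⁰` is σ_s-lower semi-continuous, then the
function `F(x) = sup_{V ∈ 𝒱(x)} inf { f_s(xt) : xt ∈ V ∩ L⁰ₛ(X) }` on `L⁰(X)` is well
defined (each `V ∩ L⁰ₛ(X)` is nonempty and the suprema/infima exist), stable,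
σ_s-lower semi-continuous, and extends `f`; moreover if `f` is proper convex then
`F` is `L⁰`-proper convex. -/
theorem extension_of_sigmaS_lsc
    {Ω : Type*} [MeasurableSpace Ω] (μ : Measure Ω) [SigmaFinite μ]
    {X Y : Type*} [NormedAddCommGroup X] [NormedSpace ℝ X] [CompleteSpace X]
    [NormedAddCommGroup Y] [NormedSpace ℝ Y] [CompleteSpace Y]
    (B : X →ₗ[ℝ] Y →ₗ[ℝ] ℝ)
    (hB : ∀ (x : X) (y : Y), |B x y| ≤ ‖x‖ * ‖y‖)
    (hsepX : ∀ x : X, x ≠ 0 → ∃ y : Y, B x y ≠ 0)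
    (hsepY : ∀ y : Y, y ≠ 0 → ∃ x : X, B x y ≠ 0)
    (hballX : @IsClosed X (weakTopol B) {x : X | ‖x‖ ≤ 1})
    (hballY : @IsClosed Y (weakTopol B.flip) {y : Y | ‖y‖ ≤ 1})
    (f : X → Ω → EReal) (hf : ∀ x : X, Measurable (f x))
    (hlsc : SigmaSLsc μ B f) :
    ∃ F : (Ω → X) → Ω → EReal,
      (∀ x : Ω → X, AEStronglyMeasurable x μ → ∀ V : NbhdParam μ Y,
        ∃ xt : Ω → X, IsStep μ xt ∧ V.Mem B x xt) ∧
      IsCanonicalExt μ B f F ∧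
      StableFun μ F ∧
      SigmaSLscL0 μ B F ∧
      (∀ x : X, F (fun _ => x) =ᵐ[μ] f x) ∧
      (ProperConvex μ f → L0ProperConvex μ F) := by
  obtain ⟨F, hF⟩ := exists_isCanonicalExt (μ := μ) hB hf
  have hext := hF.ae_eq_of_lsc hlsc
  refine ⟨F, fun x hx V => ?_, hF, hF.stableFun hB, hF.sigmaSLscL0, hext,
    hF.l0ProperConvex hB hf hext⟩
  obtain ⟨p⟩ := nonempty_stepsNear hB f V hx
  exact ⟨p.1.1, p.2.1.isStep, p.2.2⟩
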